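/- Step (iv), independence of ψ_0: Under the hypotheses of Step (iii) (L^{αβ}_A symmetric first-order functions satisfying (int1) and (int2), V^0 a first-order function with ∂^0_A V^0 = (1/2) L^{00}_A and (∂^i_A ∂^j_B + ∂^j_A ∂^i_B) V^0 = T^{ij}_{AB}, and G^i_A = L^{0i}_A − ∂^i_A V^0), define for latin indices i,j ∈ {1,…,n}: L̃^{ij}_A = L^{ij}_A − ∫_0^1 Σ_C ψ^C_0 [((∂^i_A G^j_C + ∂^j_A G^i_C)) ∘ φ_s] ds. Then ∂^0_B L̃^{ij}_A = 0 for all i, j, A, B; i.e., the functions L̃^{ij}_A do not depend on the variables ψ^B_0. -/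

import Mathlib

/-!
Step (iv), independence of `ψ₀`: under the hypotheses of Step (iii), the
functions
`L̃^{ij}_A = L^{ij}_A − ∫₀¹ Σ_C ψᶜ₀ [(∂ⁱ_A Gʲ_C + ∂ʲ_A Gⁱ_C) ∘ φ_s] ds`
do not depend on the variables `ψᴮ₀`.
-/

/-- The first-order jet-type space with `n+1` base indices:
`J = ℝ^{n+1} × ℝ^N × ℝ^{N×(n+1)}`. -/
abbrev J (n N : ℕ) : Type :=
  (Fin (n+1) → ℝ) × (Fin N → ℝ) × (Fin N → Fin (n+1) → ℝ)

/-- `∂ᵅ_A f`: the partial derivative with respect to the variable `ψᴬ_α`. -/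
noncomputable def pd {n N : ℕ} (A : Fin N) (α : Fin (n+1)) (f : J n N → ℝ) :
    J n N → ℝ :=
  fun p => fderiv ℝ f p (0, 0, Pi.single A (Pi.single α (1 : ℝ)))

/-- `φ_s : J → J`, fixing all coordinates except `ψᴬ₀ ↦ s ψᴬ₀`. -/
def phi {n N : ℕ} (s : ℝ) (p : J n N) : J n N :=
  (p.1, p.2.1, fun A α => if α = 0 then s * p.2.2 A α else p.2.2 A α)

/-- `T^{ij}_{AB} = ∂ⁱ_B L^{0j}_A + ∂ʲ_B L^{0i}_A − ∂⁰_A L^{ij}_B`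
(latin indices `i, j` are the indices `1,…,n`, realized via `Fin.succ`). -/
noncomputable def Tc {n N : ℕ}
    (L : Fin (n+1) → Fin (n+1) → Fin N → J n N → ℝ)
    (i j : Fin n) (A B : Fin N) : J n N → ℝ :=
  fun p => pd B i.succ (L 0 j.succ A) p + pd B j.succ (L 0 i.succ A) p
    - pd A 0 (L i.succ j.succ B) p

/-- `Gⁱ_A = L^{0i}_A − ∂ⁱ_A V⁰`. -/
noncomputable def Gc {n N : ℕ}
    (L : Fin (n+1) → Fin (n+1) → Fin N → J n N → ℝ) (V0 : J n N → ℝ)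
    (i : Fin n) (A : Fin N) : J n N → ℝ :=
  fun p => L 0 i.succ A p - pd A i.succ V0 p

/-- `L̃^{ij}_A = L^{ij}_A − ∫₀¹ Σ_C ψᶜ₀ [(∂ⁱ_A Gʲ_C + ∂ʲ_A Gⁱ_C) ∘ φ_s] ds`. -/
noncomputable def Lt {n N : ℕ}
    (L : Fin (n+1) → Fin (n+1) → Fin N → J n N → ℝ) (V0 : J n N → ℝ)
    (i j : Fin n) (A : Fin N) : J n N → ℝ :=
  fun p => L i.succ j.succ A p - ∫ s in (0:ℝ)..1, ∑ C, p.2.2 C 0 *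
    ((fun q => pd A i.succ (Gc L V0 j C) q + pd A j.succ (Gc L V0 i C) q)
      (phi s p))

theorem contDiff_pd {n N : ℕ} {f : J n N → ℝ} (hf : ContDiff ℝ (⊤ : ℕ∞) f)
    (A : Fin N) (α : Fin (n+1)) : ContDiff ℝ (⊤ : ℕ∞) (pd A α f) :=
  (hf.fderiv_right (m := (⊤ : ℕ∞)) (by simp)).clm_apply contDiff_const

theorem pd_sub {n N : ℕ} {f g : J n N → ℝ} {p : J n N} (hf : DifferentiableAt ℝ f p)
    (hg : DifferentiableAt ℝ g p) (A : Fin N) (α : Fin (n+1)) :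
    pd A α (fun q => f q - g q) p = pd A α f p - pd A α g p := by
  simp only [pd]
  rw [fderiv_fun_sub hf hg]
  rfl

theorem contDiff_phi {n N : ℕ} :
    ContDiff ℝ (⊤ : ℕ∞) (fun x : ℝ × J n N => phi x.1 x.2) := by
  unfold phi
  refine ContDiff.prodMk (by fun_prop) (ContDiff.prodMk (by fun_prop) ?_)
  refine contDiff_pi.2 fun A => contDiff_pi.2 fun α => ?_
  split_ifs <;> fun_prop

theorem phi_one {n N : ℕ} (p : J n N) : phi 1 p = p := by
  simp [phi]

theorem phi_zero_add_smul_single {n N : ℕ} (p : J n N) (B : Fin N) (t : ℝ) :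
    phi 0 (p + t • ((0, 0, Pi.single B (Pi.single 0 (1 : ℝ))) : J n N)) = phi 0 p := by
  refine Prod.ext (by simp [phi]) (Prod.ext (by simp [phi]) ?_)
  funext A α
  by_cases hα : α = 0
  · simp [phi, hα]
  · by_cases hA : A = B
    · subst hA
      simp [phi, hα]
    · simp [phi, hα, hA]

theorem hasDerivAt_phi {n N : ℕ} (p : J n N) (s : ℝ) :
    HasDerivAt (fun s => phi s p)
      (∑ C, p.2.2 C 0 • ((0, 0, Pi.single C (Pi.single 0 (1 : ℝ))) : J n N)) s := by
  have hsum : (∑ C, p.2.2 C 0 • ((0, 0, Pi.single C (Pi.single 0 (1 : ℝ))) : J n N)) =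
      (0, 0, fun A α => if α = 0 then p.2.2 A α else 0) := by
    refine Prod.ext (by simp [Prod.fst_sum])
      (Prod.ext (by simp [Prod.fst_sum, Prod.snd_sum]) ?_)
    funext A α
    simp only [Prod.snd_sum, Finset.sum_apply, Prod.smul_snd, Pi.smul_apply, smul_eq_mul]
    rw [Finset.sum_eq_single A (fun C _ hC => by simp [Pi.single_eq_of_ne hC.symm]) (by simp)]
    by_cases hα : α = 0
    · simp [hα]
    · simp [hα]
  rw [hsum]
  refine (hasDerivAt_const s p.1).prodMk ((hasDerivAt_const s p.2.1).prodMk ?_)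
  refine hasDerivAt_pi.2 fun A => hasDerivAt_pi.2 fun α => ?_
  split_ifs
  · simpa using (hasDerivAt_id s).mul_const (p.2.2 A α)
  · exact hasDerivAt_const s _

/-- The fundamental theorem of calculus along `s ↦ φ_s p`. -/
theorem integral_sum_mul_pd_phi {n N : ℕ} {f : J n N → ℝ} (hf : ContDiff ℝ (⊤ : ℕ∞) f)
    (p : J n N) :
    ∫ s in (0:ℝ)..1, ∑ C, p.2.2 C 0 * pd C 0 f (phi s p) = f p - f (phi 0 p) := by
  have hder : ∀ s : ℝ, HasDerivAt (fun s => f (phi s p))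
      (∑ C, p.2.2 C 0 * pd C 0 f (phi s p)) s := by
    intro s
    have h := ((hf.differentiable (by simp)) (phi s p)).hasFDerivAt.comp_hasDerivAt s
      (hasDerivAt_phi p s)
    simp only [map_sum, map_smul, smul_eq_mul] at h
    exact h
  have hphi : Continuous fun s : ℝ => phi s p :=
    contDiff_phi.continuous.comp (by fun_prop : Continuous fun s : ℝ => (s, p))
  have hcont : Continuous fun s : ℝ => ∑ C, p.2.2 C 0 * pd C 0 f (phi s p) :=
    continuous_finsetSum _ fun C _ =>
      continuous_const.mul ((contDiff_pd hf C 0).continuous.comp hphi)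
  rw [intervalIntegral.integral_eq_sub_of_hasDerivAt (fun s _ => hder s)
    (hcont.intervalIntegrable 0 1), phi_one]

theorem pd_zero_comp_phi_zero {n N : ℕ} {f : J n N → ℝ} (hf : ContDiff ℝ (⊤ : ℕ∞) f)
    (B : Fin N) (p : J n N) : pd B 0 (fun q => f (phi 0 q)) p = 0 := by
  have hdiff : DifferentiableAt ℝ (fun q : J n N => f (phi 0 q)) p :=
    ((hf.comp (contDiff_phi.comp (contDiff_const.prodMk contDiff_id))).differentiable
      (by simp)) p
  rw [pd, ← hdiff.lineDeriv_eq_fderiv, lineDeriv]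
  simp only [phi_zero_add_smul_single, deriv_const]

theorem step_iv_independence (n N : ℕ) (hn : 0 < n) (hN : 0 < N)
    (L : Fin (n+1) → Fin (n+1) → Fin N → J n N → ℝ)
    (hLsmooth : ∀ α β A, ContDiff ℝ (⊤ : ℕ∞) (L α β A))
    (hLsym : ∀ α β A, L α β A = L β α A)
    (hint1 : ∀ (μ ν ρ : Fin (n+1)) (A B : Fin N) (p : J n N),
      pd B ρ (L μ ν A) p + pd B μ (L ρ ν A) p + pd B ν (L μ ρ A) p =
      pd A ρ (L μ ν B) p + pd A μ (L ρ ν B) p + pd A ν (L μ ρ B) p)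
    (hint2 : ∀ (μ ν ρ σ : Fin (n+1)) (A B C : Fin N) (p : J n N),
      pd B μ (fun q => pd C ρ (L σ ν A) q + pd C σ (L ρ ν A) q) p
      + pd B ν (fun q => pd C ρ (L σ μ A) q + pd C σ (L ρ μ A) q) p
      - (pd A μ (pd B ν (L σ ρ C)) p + pd A ν (pd B μ (L σ ρ C)) p)
      - (pd A ρ (pd C σ (L μ ν B)) p + pd A σ (pd C ρ (L μ ν B)) p) = 0)
    (V0 : J n N → ℝ) (hV0smooth : ContDiff ℝ (⊤ : ℕ∞) V0)
    (hV01 : ∀ (A : Fin N) (p : J n N), pd A 0 V0 p = (1/2) * L 0 0 A p)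
    (hV02 : ∀ (i j : Fin n) (A B : Fin N) (p : J n N),
      pd A i.succ (pd B j.succ V0) p + pd A j.succ (pd B i.succ V0) p =
      Tc L i j A B p) :
    ∀ (i j : Fin n) (A B : Fin N) (p : J n N),
      pd B 0 (Lt L V0 i j A) p = 0 := by
  intro i j A B p
  have hGc : ∀ (k l : Fin n) (C : Fin N) (q : J n N), pd A k.succ (Gc L V0 l C) q =
      pd A k.succ (L 0 l.succ C) q - pd A k.succ (pd C l.succ V0) q := fun k l C q =>
    pd_sub ((hLsmooth 0 l.succ C).differentiable (by simp) q)
      ((contDiff_pd hV0smooth C l.succ).differentiable (by simp) q) A k.succ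
  have hG : ∀ (C : Fin N) (q : J n N),
      pd A i.succ (Gc L V0 j C) q + pd A j.succ (Gc L V0 i C) q =
        pd C 0 (L i.succ j.succ A) q := by
    intro C q
    have h1 := hint1 i.succ j.succ 0 A C q
    have h2 := hV02 i j A C q
    rw [hLsym i.succ 0 A, hLsym i.succ 0 C] at h1
    rw [Tc] at h2
    rw [hGc, hGc]
    linarith
  have hLt : Lt L V0 i j A = fun q => L i.succ j.succ A (phi 0 q) := by
    funext q
    simp only [Lt, hG]
    rw [integral_sum_mul_pd_phi (hLsmooth _ _ _)]
    ring
  rw [hLt]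
  exact pd_zero_comp_phi_zero (hLsmooth _ _ _) B p
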